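/- For all non-negative integers m and n, ∑_{i=−n}^{n} ∑_{j=−m}^{m} |j² − i²| · C(2n, n+i) · C(2m, m+j) ≥ 2nm · C(2n, n) · C(2m, m), and equality holds if and only if m = n. -/

import Mathlib

/-- Binomial coefficient `C(a, b)` with natural upper index and integer lower
index: it vanishes when `b < 0` (and also when `b > a`, via `Nat.choose`). -/
def zchoose (a : ℕ) (b : ℤ) : ℚ :=
  if 0 ≤ b then (a.choose b.toNat : ℚ) else 0

/-- The symmetric binomial coefficient `C(2n, n + i)`. -/
def symmChoose (n : ℕ) (i : ℤ) : ℚ := zchoose (2 * n) ((n : ℤ) + i)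

/-- The sign of `|j| - |i|`. -/
noncomputable def absSign (i j : ℤ) : ℚ := if |i| < |j| then 1 else if |j| < |i| then -1 else 0

/-- The sum of `h` over `[-n, n]` weighted by the symmetric binomial coefficients. -/
noncomputable def binomSum (n : ℕ) (h : ℤ → ℚ) : ℚ :=
  ∑ i ∈ Finset.Icc (-(n : ℤ)) (n : ℤ), h i * symmChoose n i

/-- The double sum of the sign of `|j| - |i|`. -/
noncomputable def signSum (n m : ℕ) : ℚ := binomSum n fun i => binomSum m fun j => absSign i j

theorem zchoose_eq_zero_of_lt {a : ℕ} {b : ℤ} (h : (a : ℤ) < b) : zchoose a b = 0 := by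
  unfold zchoose
  split_ifs with hb
  · rw [Nat.choose_eq_zero_of_lt (by omega), Nat.cast_zero]
  · rfl

theorem zchoose_succ (a : ℕ) (b : ℤ) :
    zchoose (a + 1) b = zchoose a b + zchoose a (b - 1) := by
  rcases lt_trichotomy b 0 with hb | rfl | hb
  · simp [zchoose, hb.not_ge, show ¬ (1 : ℤ) ≤ b by omega]
  · simp [zchoose]
  · obtain ⟨k, rfl⟩ : ∃ k : ℕ, b = k + 1 := ⟨(b - 1).toNat, by omega⟩
    have h : ((k : ℤ) + 1).toNat = k + 1 := by omega
    simp only [zchoose, add_sub_cancel_right, h, Int.toNat_natCast, hb.le, if_true,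
      Int.natCast_nonneg, Nat.choose_succ_succ', Nat.cast_add]
    ring

theorem zchoose_add_one_mul (a : ℕ) (b : ℤ) :
    ((b : ℚ) + 1) * zchoose a (b + 1) = ((a : ℚ) - b) * zchoose a b := by
  rcases lt_or_ge b 0 with hb | hb
  · rcases eq_or_lt_of_le (show b ≤ -1 by omega) with rfl | h
    · simp [zchoose]
    · simp [zchoose, hb.not_ge, show ¬ (0 : ℤ) ≤ b + 1 by omega]
  · lift b to ℕ using hb
    have h : ((b : ℤ) + 1).toNat = b + 1 := by omega
    simp only [zchoose, h, Int.toNat_natCast, show (0 : ℤ) ≤ (b : ℤ) + 1 by omega, if_true,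
      Int.natCast_nonneg, Int.cast_natCast]
    rcases le_or_gt b a with hba | hba
    · have := Nat.choose_succ_right_eq a b
      have h2 : ((a.choose (b + 1) : ℕ) : ℚ) * ((b : ℚ) + 1) = a.choose b * ((a : ℚ) - b) := by
        rw [← Nat.cast_sub hba]
        exact_mod_cast this
      linear_combination h2
    · simp [Nat.choose_eq_zero_of_lt hba, Nat.choose_eq_zero_of_lt (Nat.lt_succ_of_lt hba)]

theorem symmChoose_eq_zero {n : ℕ} {i : ℤ} (h : i ∉ Finset.Icc (-(n : ℤ)) (n : ℤ)) :
    symmChoose n i = 0 := by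
  rw [Finset.mem_Icc] at h
  unfold symmChoose
  rcases lt_or_ge ((n : ℤ) + i) 0 with hi | hi
  · simp [zchoose, hi.not_ge]
  · exact zchoose_eq_zero_of_lt (by push_cast; omega)

theorem symmChoose_zero (n : ℕ) : symmChoose n 0 = n.centralBinom := by
  simp [symmChoose, zchoose, Nat.centralBinom]

theorem symmChoose_neg (n : ℕ) (i : ℤ) : symmChoose n (-i) = symmChoose n i := by
  by_cases h : i ∈ Finset.Icc (-(n : ℤ)) (n : ℤ)
  · rw [Finset.mem_Icc] at h
    simp only [symmChoose, zchoose, show 0 ≤ (n : ℤ) + i by omega,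
      show 0 ≤ (n : ℤ) + -i by omega, if_true]
    rw [Nat.choose_symm_of_eq_add (a := ((n : ℤ) + -i).toNat) (b := ((n : ℤ) + i).toNat)
      (by omega)]
  · rw [symmChoose_eq_zero h, symmChoose_eq_zero]
    rw [Finset.mem_Icc] at h ⊢
    omega

theorem symmChoose_add_one_mul (n : ℕ) (i : ℤ) :
    ((n : ℚ) + 1 + i) * symmChoose n (i + 1) = ((n : ℚ) - i) * symmChoose n i := by
  have h := zchoose_add_one_mul (2 * n) ((n : ℤ) + i)
  push_cast at h
  rw [symmChoose, symmChoose, ← add_assoc]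
  linear_combination h

theorem symmChoose_sub_one_mul (n : ℕ) (i : ℤ) :
    ((n : ℚ) + 1 - i) * symmChoose n (i - 1) = ((n : ℚ) + i) * symmChoose n i := by
  have h := symmChoose_add_one_mul n (i - 1)
  rw [sub_add_cancel] at h
  push_cast at h
  linear_combination -h

theorem symmChoose_succ (n : ℕ) (i : ℤ) :
    symmChoose (n + 1) i = symmChoose n (i - 1) + 2 * symmChoose n i + symmChoose n (i + 1) := by
  simp only [symmChoose, show 2 * (n + 1) = 2 * n + 1 + 1 by ring, zchoose_succ]
  push_cast
  rw [show (n : ℤ) + 1 + i - 1 - 1 = n + (i - 1) by ring,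
    show (n : ℤ) + 1 + i - 1 = n + i by ring, show (n : ℤ) + 1 + i = n + (i + 1) by ring]
  ring

theorem sq_sub_sq_mul_symmChoose_succ (n : ℕ) (i : ℤ) :
    (((n : ℚ) + 1) ^ 2 - (i : ℚ) ^ 2) * symmChoose (n + 1) i
      = 2 * ((n : ℚ) + 1) * (2 * n + 1) * symmChoose n i := by
  rw [symmChoose_succ]
  linear_combination ((n : ℚ) + 1 - i) * symmChoose_add_one_mul n i
    + ((n : ℚ) + 1 + i) * symmChoose_sub_one_mul n i

theorem symmChoose_sub_one_sub_add_one (n : ℕ) (i : ℤ) :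
    symmChoose n (i - 1) - symmChoose n (i + 1) = i / ((n : ℚ) + 1) * symmChoose (n + 1) i := by
  have hn : (n : ℚ) + 1 ≠ 0 := by positivity
  rw [symmChoose_succ]
  field_simp
  linear_combination symmChoose_sub_one_mul n i - symmChoose_add_one_mul n i

theorem symmChoose_zero_sub_one (n : ℕ) :
    2 * (symmChoose n 0 - symmChoose n 1) = symmChoose (n + 1) 0 / (2 * (n : ℚ) + 1) := by
  have hn : (2 : ℚ) * n + 1 ≠ 0 := by positivity
  have hn' : (n : ℚ) + 1 ≠ 0 := by positivity
  have h1 := symmChoose_add_one_mul n 0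
  have h2 := symmChoose_succ n 0
  have h3 := symmChoose_neg n 1
  norm_num at h1 h2 h3
  rw [h3] at h2
  rw [h2, eq_div_iff hn]
  apply mul_left_cancel₀ hn'
  linear_combination (-(4 * (n : ℚ) + 4)) * h1

theorem sum_Icc_mul_symmChoose {n : ℕ} {a b : ℤ} (ha : a ≤ -n) (hb : n ≤ b) (h : ℤ → ℚ) :
    ∑ i ∈ Finset.Icc a b, h i * symmChoose n i = binomSum n h := by
  refine (Finset.sum_subset (Finset.Icc_subset_Icc ha hb) fun i _ hi => ?_).symm
  rw [symmChoose_eq_zero hi, mul_zero]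

theorem sum_Icc_mul_symmChoose_add {n : ℕ} {a b : ℤ} (c : ℤ) (ha : a + c ≤ -n) (hb : n ≤ b + c)
    (h : ℤ → ℚ) :
    ∑ i ∈ Finset.Icc a b, h i * symmChoose n (i + c) = binomSum n fun i => h (i - c) := by
  rw [← sum_Icc_mul_symmChoose ha hb, ← Finset.map_add_right_Icc, Finset.sum_map]
  simp

theorem binomSum_succ (n : ℕ) (h : ℤ → ℚ) :
    binomSum (n + 1) h = binomSum n fun i => h (i - 1) + 2 * h i + h (i + 1) := by
  have h1 := sum_Icc_mul_symmChoose_add (n := n) (a := -((n + 1 : ℕ) : ℤ)) (b := ((n + 1 : ℕ) : ℤ))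
    (-1) (by push_cast; omega) (by push_cast; omega) h
  have h2 := sum_Icc_mul_symmChoose (n := n) (a := -((n + 1 : ℕ) : ℤ)) (b := ((n + 1 : ℕ) : ℤ))
    (by push_cast; omega) (by push_cast; omega) h
  have h3 := sum_Icc_mul_symmChoose_add (n := n) (a := -((n + 1 : ℕ) : ℤ)) (b := ((n + 1 : ℕ) : ℤ))
    1 (by push_cast; omega) (by push_cast; omega) h
  simp only [sub_neg_eq_add, ← sub_eq_add_neg] at h1
  simp only [binomSum, add_mul, mul_assoc, Finset.sum_add_distrib, ← Finset.mul_sum] at h1 h2 h3 ⊢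
  rw [← h1, ← h2, ← h3, Finset.mul_sum, ← Finset.sum_add_distrib, ← Finset.sum_add_distrib]
  refine Finset.sum_congr rfl fun i _ => ?_
  rw [symmChoose_succ]
  ring

theorem binomSum_add (n : ℕ) (f g : ℤ → ℚ) :
    binomSum n (fun i => f i + g i) = binomSum n f + binomSum n g := by
  simp only [binomSum, add_mul, Finset.sum_add_distrib]

theorem binomSum_sub (n : ℕ) (f g : ℤ → ℚ) :
    binomSum n (fun i => f i - g i) = binomSum n f - binomSum n g := by
  simp only [binomSum, sub_mul, Finset.sum_sub_distrib]

theorem binomSum_const_mul (n : ℕ) (c : ℚ) (f : ℤ → ℚ) :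
    binomSum n (fun i => c * f i) = c * binomSum n f := by
  simp only [binomSum, mul_assoc, Finset.mul_sum]

theorem binomSum_single (n : ℕ) (a : ℤ) :
    binomSum n (fun i => if i = a then 1 else 0) = symmChoose n a := by
  simp only [binomSum, ite_mul, one_mul, zero_mul, Finset.sum_ite_eq']
  split_ifs with h
  · rfl
  · rw [symmChoose_eq_zero h]

theorem binomSum_comm (n m : ℕ) (f : ℤ → ℤ → ℚ) :
    (binomSum n fun i => binomSum m fun j => f i j)
      = binomSum m fun j => binomSum n fun i => f i j := by
  simp only [binomSum, Finset.sum_mul]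
  rw [Finset.sum_comm]
  exact Finset.sum_congr rfl fun j _ => Finset.sum_congr rfl fun i _ => by ring

theorem absSign_abs_left (i j : ℤ) : absSign |i| j = absSign i j := by
  simp [absSign]

theorem absSign_swap (i j : ℤ) : absSign j i = -1 * absSign i j := by
  unfold absSign
  split_ifs <;> first | omega | norm_num

theorem cast_abs_sq_sub_sq (i j : ℤ) :
    ((|j ^ 2 - i ^ 2| : ℤ) : ℚ) = absSign i j * ((j : ℚ) ^ 2 - (i : ℚ) ^ 2) := by
  unfold absSign
  split_ifs with h h'
  · rw [abs_of_pos (sub_pos.2 (sq_lt_sq.2 h))]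
    push_cast
    ring
  · rw [abs_of_neg (sub_neg.2 (sq_lt_sq.2 h'))]
    push_cast
    ring
  · rw [(sq_eq_sq_iff_abs_eq_abs j i).2 (by omega)]
    simp

theorem absSign_zero_second_difference (j : ℤ) :
    absSign 0 (j - 1) + 2 * absSign 0 j + absSign 0 (j + 1)
      = 4 * absSign 0 j + 2 * (if j = 0 then 1 else 0) - (if j = 1 then 1 else 0)
        - (if j = -1 then 1 else 0) := by
  have h (k : ℤ) : absSign 0 k = if k = 0 then 0 else 1 := by
    unfold absSign
    split_ifs <;> first | rfl | (exfalso; simp_all)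
  simp only [h]
  split_ifs <;> first | omega | norm_num

theorem absSign_second_difference {i : ℤ} (hi : 0 < i) (j : ℤ) :
    absSign i (j - 1) + 2 * absSign i j + absSign i (j + 1)
      = 4 * absSign i j + (if j = i - 1 then 1 else 0) - (if j = i + 1 then 1 else 0)
        + (if j = -(i - 1) then 1 else 0) - (if j = -(i + 1) then 1 else 0) := by
  have h (k : ℤ) : absSign i k = if k < -i then 1 else if k = -i then 0 else
      if k < i then -1 else if k = i then 0 else 1 := by
    unfold absSign
    grind
  simp only [h]
  grind (splits := 30)

theorem binomSum_absSign_succ (m : ℕ) (i : ℤ) :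
    binomSum (m + 1) (absSign i) = 4 * binomSum m (absSign i)
      + 2 / ((m : ℚ) + 1) * (((|i| : ℤ) : ℚ) * symmChoose (m + 1) i)
      + symmChoose (m + 1) 0 / (2 * (m : ℚ) + 1) * (if i = 0 then 1 else 0) := by
  rcases eq_or_ne i 0 with rfl | hi
  · simp only [binomSum_succ, absSign_zero_second_difference, binomSum_add, binomSum_sub,
      binomSum_const_mul, binomSum_single, symmChoose_neg, ← symmChoose_zero_sub_one]
    simp
    ring
  · have key := symmChoose_sub_one_sub_add_one m |i|
    have hA : symmChoose (m + 1) |i| = symmChoose (m + 1) i := by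
      rcases abs_choice i with h | h <;> rw [h]
      exact symmChoose_neg _ _
    rw [← funext (absSign_abs_left i), ← hA, if_neg hi]
    simp only [binomSum_succ, absSign_second_difference (abs_pos.2 hi), binomSum_add, binomSum_sub,
      binomSum_const_mul, binomSum_single, symmChoose_neg]
    linear_combination 2 * key

theorem sum_range_mul_symmChoose_mul (n p N : ℕ) :
    2 * ((n : ℚ) + p) * ∑ k ∈ Finset.range N, (k : ℚ) * symmChoose p k * symmChoose n k
      = n * p * symmChoose n 0 * symmChoose p 0
        - (n + N) * (p + N) * symmChoose n N * symmChoose p N := by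
  induction N with
  | zero => simp
  | succ N ih =>
    rw [Finset.sum_range_succ, mul_add, ih]
    have h1 := symmChoose_add_one_mul n N
    have h2 := symmChoose_add_one_mul p N
    push_cast at h1 h2 ⊢
    linear_combination ((p : ℚ) + 1 + N) * symmChoose p (N + 1) * h1
      + ((n : ℚ) - N) * symmChoose n N * h2

theorem binomSum_abs_mul_symmChoose (n p : ℕ) (hp : 0 < p) :
    binomSum n (fun i => ((|i| : ℤ) : ℚ) * symmChoose p i)
      = n * p / (n + p) * (symmChoose n 0 * symmChoose p 0) := by
  have hnp : (n : ℚ) + p ≠ 0 := by positivity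
  have h := sum_range_mul_symmChoose_mul n p (n + 1)
  rw [symmChoose_eq_zero (n := n) (i := (n + 1 : ℕ)) (by simp)] at h
  rw [binomSum, Finset.sum_Icc_of_even_eq_range
    (fun i => by simp only [abs_neg, symmChoose_neg])]
  simp only [abs_zero, Int.cast_zero, zero_mul, sub_zero, Nat.abs_cast, Int.cast_natCast,
    nsmul_eq_mul, Nat.cast_ofNat]
  field_simp
  linear_combination h

theorem signSum_succ (n m : ℕ) :
    signSum n (m + 1) = 4 * signSum n m + symmChoose n 0 * symmChoose (m + 1) 0 *
      (2 * n / (n + (m + 1)) + 1 / (2 * m + 1)) := by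
  have hm : (m : ℚ) + 1 ≠ 0 := by positivity
  have h := binomSum_abs_mul_symmChoose n (m + 1) m.succ_pos
  change (binomSum n fun i => binomSum (m + 1) (absSign i)) = _
  simp only [binomSum_absSign_succ, binomSum_add, binomSum_const_mul, binomSum_single, h]
  change 4 * signSum n m + _ + _ = _
  push_cast
  field_simp
  ring

theorem signSum_swap (n m : ℕ) : signSum m n = -signSum n m := by
  have h : signSum m n = binomSum n fun i => binomSum m fun j => -1 * absSign i j := by
    simp only [← absSign_swap]
    exact binomSum_comm m n absSign
  rw [h]
  simp only [binomSum_const_mul]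
  exact neg_one_mul _

theorem symmChoose_zero_pos (n : ℕ) : 0 < symmChoose n 0 := by
  rw [symmChoose_zero]
  exact_mod_cast n.centralBinom_pos

theorem signSum_nonneg {n m : ℕ} (h : n ≤ m) : 0 ≤ signSum n m := by
  induction m, h using Nat.le_induction with
  | base => linarith [signSum_swap n n]
  | succ m _ ih =>
    rw [signSum_succ]
    have := symmChoose_zero_pos n
    have := symmChoose_zero_pos (m + 1)
    positivity

theorem binomSum_sq_mul_succ (m : ℕ) (h : ℤ → ℚ) :
    binomSum (m + 1) (fun j => (j : ℚ) ^ 2 * h j)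
      = ((m : ℚ) + 1) ^ 2 * binomSum (m + 1) h - 2 * ((m : ℚ) + 1) * (2 * m + 1) * binomSum m h := by
  rw [← sum_Icc_mul_symmChoose (n := m) (a := -((m + 1 : ℕ) : ℤ)) (b := ((m + 1 : ℕ) : ℤ))
    (by push_cast; omega) (by push_cast; omega) h]
  simp only [binomSum, Finset.mul_sum, ← Finset.sum_sub_distrib]
  refine Finset.sum_congr rfl fun j _ => ?_
  linear_combination (-h j) * sq_sub_sq_mul_symmChoose_succ m j

theorem binomSum_sq_mul_absSign (n m : ℕ) :
    (binomSum n fun i => binomSum m fun j => (j : ℚ) ^ 2 * absSign i j)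
      = m / 2 * signSum n m + symmChoose n 0 * symmChoose m 0 *
        (m * n * (2 * m - 1) / (n + m) + m / 2) := by
  cases m with
  | zero => simp [binomSum]
  | succ m =>
    have h := signSum_succ n m
    have hnm : (n : ℚ) + (m + 1) ≠ 0 := by positivity
    have hm : 2 * (m : ℚ) + 1 ≠ 0 := by positivity
    simp only [binomSum_sq_mul_succ, binomSum_sub, binomSum_const_mul]
    change _ * signSum n (m + 1) - _ * signSum n m = _
    rw [show signSum n m = (signSum n (m + 1) - symmChoose n 0 * symmChoose (m + 1) 0 *
      (2 * n / (n + (m + 1)) + 1 / (2 * m + 1))) / 4 by rw [h]; ring]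
    push_cast
    field_simp
    ring

theorem binomSum_abs_sq_sub_sq (n m : ℕ) :
    (binomSum n fun i => binomSum m fun j => ((|j ^ 2 - i ^ 2| : ℤ) : ℚ))
      = 2 * n * m * (symmChoose n 0 * symmChoose m 0)
        + ((m : ℚ) - n) / 2 * signSum n m
        + symmChoose n 0 * symmChoose m 0 * (((m : ℚ) - n) ^ 2 / (2 * (n + m))) := by
  have h1 := binomSum_sq_mul_absSign n m
  have h2 := binomSum_sq_mul_absSign m n
  rw [binomSum_comm, signSum_swap n m] at h2
  have h (i j : ℤ) : ((|j ^ 2 - i ^ 2| : ℤ) : ℚ)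
      = (j : ℚ) ^ 2 * absSign i j + (i : ℚ) ^ 2 * absSign j i := by
    rw [cast_abs_sq_sub_sq, absSign_swap i j]
    ring
  simp only [h, binomSum_add, h1, h2]
  rcases eq_or_ne (n + m) 0 with h0 | h0
  · obtain ⟨rfl, rfl⟩ : n = 0 ∧ m = 0 := by omega
    simp
  · have h1 : (n : ℚ) + m ≠ 0 := by exact_mod_cast h0
    rw [add_comm (m : ℚ) n]
    field_simp
    ring

theorem sub_mul_signSum_nonneg (n m : ℕ) : 0 ≤ ((m : ℚ) - n) / 2 * signSum n m := by
  rcases le_total n m with h | h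
  · have : (n : ℚ) ≤ m := by exact_mod_cast h
    exact mul_nonneg (by linarith) (signSum_nonneg h)
  · have : (m : ℚ) ≤ n := by exact_mod_cast h
    have := signSum_nonneg h
    rw [signSum_swap n m] at this
    exact mul_nonneg_of_nonpos_of_nonpos (by linarith) (by linarith)

/-- Theorem 7.1 of Krattenthaler–Schneider (Conjecture 3.1 of
Brent–Ohtsuka–Osborn–Prodinger), together with the characterisation of the
equality case. -/
theorem abs_double_sum_inequality (m n : ℕ) :
    2 * (n : ℚ) * (m : ℚ) * ((2 * n).choose n : ℚ) * ((2 * m).choose m : ℚ)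
      ≤ ∑ i ∈ Finset.Icc (-(n : ℤ)) (n : ℤ), ∑ j ∈ Finset.Icc (-(m : ℤ)) (m : ℤ),
          ((|j ^ 2 - i ^ 2| : ℤ) : ℚ) *
            zchoose (2 * n) ((n : ℤ) + i) * zchoose (2 * m) ((m : ℤ) + j) ∧
    ((∑ i ∈ Finset.Icc (-(n : ℤ)) (n : ℤ), ∑ j ∈ Finset.Icc (-(m : ℤ)) (m : ℤ),
          ((|j ^ 2 - i ^ 2| : ℤ) : ℚ) *
            zchoose (2 * n) ((n : ℤ) + i) * zchoose (2 * m) ((m : ℤ) + j))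
        = 2 * (n : ℚ) * (m : ℚ) * ((2 * n).choose n : ℚ) * ((2 * m).choose m : ℚ)
      ↔ m = n) := by
  have hS : (∑ i ∈ Finset.Icc (-(n : ℤ)) (n : ℤ), ∑ j ∈ Finset.Icc (-(m : ℤ)) (m : ℤ),
      ((|j ^ 2 - i ^ 2| : ℤ) : ℚ) *
        zchoose (2 * n) ((n : ℤ) + i) * zchoose (2 * m) ((m : ℤ) + j))
      = binomSum n fun i => binomSum m fun j => ((|j ^ 2 - i ^ 2| : ℤ) : ℚ) := by
    simp only [binomSum, symmChoose, Finset.sum_mul]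
    exact Finset.sum_congr rfl fun i _ => Finset.sum_congr rfl fun j _ => by ring
  have hc (k : ℕ) : ((2 * k).choose k : ℚ) = symmChoose k 0 := by
    rw [symmChoose_zero, Nat.centralBinom]
  rw [hS, hc, hc, binomSum_abs_sq_sub_sq]
  have hpos := mul_pos (symmChoose_zero_pos n) (symmChoose_zero_pos m)
  have hU := sub_mul_signSum_nonneg n m
  have hsq : 0 ≤ symmChoose n 0 * symmChoose m 0 * (((m : ℚ) - n) ^ 2 / (2 * (n + m))) := by
    positivity
  refine ⟨by linarith, fun h => ?_, ?_⟩
  · by_contra hmn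
    have h0 : (0 : ℚ) < n + m := by
      have : 0 < n + m := by omega
      exact_mod_cast this
    have h1 : (m : ℚ) - n ≠ 0 := sub_ne_zero.2 (by exact_mod_cast hmn)
    have : 0 < symmChoose n 0 * symmChoose m 0 * (((m : ℚ) - n) ^ 2 / (2 * (n + m))) := by
      positivity
    linarith
  · rintro rfl
    simp only [sub_self]
    ring
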